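/- Let A ∈ ℂ^{m×n} be a nonzero matrix, r_1,…,r_m ∈ ℂ^n the conjugate transposes of the m rows of A, v ∈ ℂ^n a right singular vector corresponding to the largest singular value of A (i.e. v ≠ 0 and ‖Av‖_2 = ‖A‖_{2→2}‖v‖_2), and S = {v, r_1, …, r_m}. Then for all real numbers p, q ∈ [2, ∞): max_{x ∈ S, x ≠ 0} ‖Ax‖_q/‖x‖_p ≥ [ (2 m^{1/q})^{(q−2)/(q−1)} · n^{(p−2)/p} ]^{−1/2} · ‖A‖_{p→q}. -/

import Mathlib

open scoped BigOperators

/-- The `ℓ_p` norm of a vector, for a real exponent `p`. -/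
noncomputable def lpnorm {n : ℕ} {𝕜 : Type*} [RCLike 𝕜] (p : ℝ) (x : Fin n → 𝕜) : ℝ :=
  (∑ i, ‖x i‖ ^ p) ^ (1 / p)

/-- The `ℓ_∞` norm of a vector. -/
noncomputable def linorm {n : ℕ} {𝕜 : Type*} [RCLike 𝕜] (x : Fin n → 𝕜) : ℝ :=
  ⨆ i, ‖x i‖

/-- The `p → q` operator norm of a matrix: `max_{x ≠ 0} ‖Ax‖_q / ‖x‖_p`. -/
noncomputable def opNorm {m n : ℕ} {𝕜 : Type*} [RCLike 𝕜] (p q : ℝ)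
    (A : Matrix (Fin m) (Fin n) 𝕜) : ℝ :=
  ⨆ x : {x : Fin n → 𝕜 // x ≠ 0}, lpnorm q (A.mulVec x.1) / lpnorm p x.1

/-- The `p → ∞` operator norm of a matrix: `max_{x ≠ 0} ‖Ax‖_∞ / ‖x‖_p`. -/
noncomputable def opNormInf {m n : ℕ} {𝕜 : Type*} [RCLike 𝕜] (p : ℝ)
    (A : Matrix (Fin m) (Fin n) 𝕜) : ℝ :=
  ⨆ x : {x : Fin n → 𝕜 // x ≠ 0}, linorm (A.mulVec x.1) / lpnorm p x.1

/-- `row A i` is the conjugate transpose of the `i`-th row of `A`,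
so that `(A x) i = ⟨x, row A i⟩` for the standard Hermitian inner product. -/
def row {m n : ℕ} {𝕜 : Type*} [RCLike 𝕜] (A : Matrix (Fin m) (Fin n) 𝕜) (i : Fin m) :
    Fin n → 𝕜 := fun k => star (A i k)

/-- The standard Hermitian inner product `⟨x, y⟩ = ∑ k, x k * conj (y k)`. -/
noncomputable def hinner {n : ℕ} (x y : Fin n → ℂ) : ℂ := ∑ k, x k * star (y k)

theorem lpnorm_nonneg {n : ℕ} {𝕜 : Type*} [RCLike 𝕜] (p : ℝ) (x : Fin n → 𝕜) :
    0 ≤ lpnorm p x :=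
  Real.rpow_nonneg (Finset.sum_nonneg fun _ _ => Real.rpow_nonneg (norm_nonneg _) _) _

theorem lpnorm_rpow {n : ℕ} {𝕜 : Type*} [RCLike 𝕜] {p : ℝ} (hp : p ≠ 0) (x : Fin n → 𝕜) :
    lpnorm p x ^ p = ∑ i, ‖x i‖ ^ p := by
  rw [lpnorm, one_div, Real.rpow_inv_rpow _ hp]
  exact Finset.sum_nonneg fun _ _ => Real.rpow_nonneg (norm_nonneg _) _

theorem lpnorm_two_sq {n : ℕ} {𝕜 : Type*} [RCLike 𝕜] (x : Fin n → 𝕜) :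
    lpnorm 2 x ^ 2 = ∑ i, ‖x i‖ ^ 2 := by
  simpa using lpnorm_rpow (p := 2) two_ne_zero x

theorem norm_le_lpnorm {n : ℕ} {𝕜 : Type*} [RCLike 𝕜] {p : ℝ} (hp : 0 < p) (x : Fin n → 𝕜)
    (i : Fin n) : ‖x i‖ ≤ lpnorm p x := by
  rw [← Real.rpow_le_rpow_iff (norm_nonneg _) (lpnorm_nonneg p x) hp, lpnorm_rpow hp.ne']
  exact Finset.single_le_sum (f := fun i => ‖x i‖ ^ p)
    (fun _ _ => Real.rpow_nonneg (norm_nonneg _) _) (Finset.mem_univ i)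

theorem lpnorm_pos {n : ℕ} {𝕜 : Type*} [RCLike 𝕜] {p : ℝ} (hp : 0 < p) {x : Fin n → 𝕜}
    (hx : x ≠ 0) : 0 < lpnorm p x := by
  obtain ⟨i, hi⟩ := Function.ne_iff.mp hx
  exact (norm_pos_iff.mpr hi).trans_le (norm_le_lpnorm hp x i)

theorem lpnorm_anti {n : ℕ} {𝕜 : Type*} [RCLike 𝕜] {p q : ℝ} (hp : 0 < p) (hpq : p ≤ q)
    (x : Fin n → 𝕜) : lpnorm q x ≤ lpnorm p x := by
  have hL := lpnorm_nonneg p x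
  rw [← Real.rpow_le_rpow_iff (lpnorm_nonneg q x) hL (hp.trans_le hpq),
    lpnorm_rpow (hp.trans_le hpq).ne']
  calc ∑ i, ‖x i‖ ^ q ≤ ∑ i, ‖x i‖ ^ p * lpnorm p x ^ (q - p) := by
        refine Finset.sum_le_sum fun i _ => ?_
        have h := Real.rpow_le_rpow (norm_nonneg _) (norm_le_lpnorm hp x i) (sub_nonneg.mpr hpq)
        calc ‖x i‖ ^ q = ‖x i‖ ^ p * ‖x i‖ ^ (q - p) := by
              rw [← Real.rpow_add' (norm_nonneg _) (by linarith)]; ring_nf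
          _ ≤ _ := mul_le_mul_of_nonneg_left h (Real.rpow_nonneg (norm_nonneg _) _)
    _ = lpnorm p x ^ q := by
        rw [← Finset.sum_mul, ← lpnorm_rpow hp.ne', ← Real.rpow_add' hL (by linarith)]
        ring_nf

theorem lpnorm_two_sq_le {n : ℕ} {𝕜 : Type*} [RCLike 𝕜] {p : ℝ} (hp : 2 ≤ p)
    (x : Fin n → 𝕜) : lpnorm 2 x ^ 2 ≤ (n : ℝ) ^ ((p - 2) / p) * lpnorm p x ^ 2 := by
  have hp0 : 0 < p := by linarith
  have h := Real.rpow_sum_le_const_mul_sum_rpow_of_nonneg (s := Finset.univ)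
    (f := fun i => ‖x i‖ ^ 2) (p := p / 2) (by linarith) fun _ _ => sq_nonneg _
  have e : ∀ i, (‖x i‖ ^ 2) ^ (p / 2) = ‖x i‖ ^ p := fun i => by
    rw [← Real.rpow_natCast, ← Real.rpow_mul (norm_nonneg _)]; congr 1; push_cast; ring
  simp only [e, ← lpnorm_rpow hp0.ne', Finset.card_univ, Fintype.card_fin] at h
  rw [← lpnorm_two_sq] at h
  have hn : (0 : ℝ) ≤ n := Nat.cast_nonneg n
  rw [← Real.rpow_le_rpow_iff (sq_nonneg _)
    (mul_nonneg (Real.rpow_nonneg hn _) (sq_nonneg _)) (half_pos hp0)]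
  refine h.trans_eq ?_
  rw [Real.mul_rpow (Real.rpow_nonneg hn _) (sq_nonneg _), ← Real.rpow_mul hn,
    ← Real.rpow_natCast (lpnorm p x), ← Real.rpow_mul (lpnorm_nonneg _ _)]
  congr 2
  · field_simp
  · push_cast; ring

theorem sum_rpow_le_interp {m : ℕ} {q : ℝ} (hq : 2 ≤ q) {b : Fin m → ℝ} (hb : ∀ i, 0 ≤ b i) :
    ∑ i, b i ^ q ≤
      (∑ i, b i ^ (2 * q)) ^ ((q - 2) / (2 * (q - 1))) * (∑ i, b i ^ 2) ^ (q / (2 * (q - 1))) := by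
  rcases hq.eq_or_lt with rfl | hq
  · norm_num
  have h1 : 0 < q - 1 := by linarith
  have h2 : 0 < q - 2 := by linarith
  have hc : (2 * (q - 1) / (q - 2)).HolderConjugate (2 * (q - 1) / q) := by
    rw [Real.holderConjugate_iff]
    constructor
    · rw [one_lt_div h2]; linarith
    · field_simp; ring
  have h := Real.inner_le_Lp_mul_Lq_of_nonneg Finset.univ hc
    (f := fun i => b i ^ (q * (q - 2) / (q - 1))) (g := fun i => b i ^ (q / (q - 1)))
    (fun i _ => Real.rpow_nonneg (hb i) _) (fun i _ => Real.rpow_nonneg (hb i) _)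
  have e1 : ∀ i, b i ^ (q * (q - 2) / (q - 1)) * b i ^ (q / (q - 1)) = b i ^ q := fun i => by
    rw [← Real.rpow_add' (hb i)]
    · congr 1; field_simp; ring
    · have : q * (q - 2) / (q - 1) + q / (q - 1) = q := by field_simp; ring
      rw [this]; linarith
  have e2 : ∀ i, (b i ^ (q * (q - 2) / (q - 1))) ^ (2 * (q - 1) / (q - 2)) = b i ^ (2 * q) :=
    fun i => by rw [← Real.rpow_mul (hb i)]; congr 1; field_simp
  have e3 : ∀ i, (b i ^ (q / (q - 1))) ^ (2 * (q - 1) / q) = b i ^ 2 := fun i => by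
    rw [← Real.rpow_mul (hb i), ← Real.rpow_natCast]; congr 1; push_cast; field_simp
  simpa only [e1, e2, e3, one_div_div] using h

theorem symm_form_le {m : ℕ} {q K : ℝ} (hq : 1 < q) {g : Fin m → Fin m → ℝ}
    (hg : ∀ i j, 0 ≤ g i j) (hs : ∀ i j, g i j = g j i)
    (hK : ∀ i, (∑ j, g i j ^ q) ^ (1 / q) ≤ K) {b : Fin m → ℝ} (hb : ∀ i, 0 ≤ b i) :
    ∑ i, ∑ j, g i j * b i ^ (2 * q - 1) * b j ^ (2 * q - 1) ≤
      2 * K * (∑ i, b i ^ (2 * q)) ^ (2 - 1 / q) := by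
  set T := ∑ i, b i ^ (2 * q) with hT
  have hT0 : 0 ≤ T := Finset.sum_nonneg fun i _ => Real.rpow_nonneg (hb i) _
  have hq1 : 0 < q - 1 := by linarith
  have hq0 : 0 < q := by linarith
  set a : Fin m → ℝ := fun i => b i ^ (2 * q - 1) with ha
  have ha0 : ∀ i, 0 ≤ a i := fun i => Real.rpow_nonneg (hb i) _
  have hc : q.HolderConjugate (q / (q - 1)) := by
    rw [Real.holderConjugate_iff]
    exact ⟨hq, by field_simp; ring⟩
  have inner : ∀ i, ∑ j, g i j * (if b j ≤ b i then a j else 0) ≤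
      K * (b i * T ^ (1 - 1 / q)) := fun i => by
    have h := Real.inner_le_Lp_mul_Lq_of_nonneg Finset.univ hc (f := g i)
      (g := fun j => if b j ≤ b i then a j else 0) (fun j _ => hg i j)
      (fun j _ => by split_ifs; exacts [ha0 j, le_rfl])
    refine h.trans (mul_le_mul (hK i) ?_ (Real.rpow_nonneg (Finset.sum_nonneg fun j _ =>
      Real.rpow_nonneg (by split_ifs; exacts [ha0 j, le_rfl]) _) _)
      ((Real.rpow_nonneg (Finset.sum_nonneg fun j _ => Real.rpow_nonneg (hg i j) _) _).trans
        (hK i)))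
    have h2 : ∑ j, (if b j ≤ b i then a j else 0) ^ (q / (q - 1)) ≤
        b i ^ (q / (q - 1)) * T := by
      rw [hT, Finset.mul_sum]
      refine Finset.sum_le_sum fun j _ => ?_
      split_ifs with hij
      · have e : a j ^ (q / (q - 1)) = b j ^ (q / (q - 1)) * b j ^ (2 * q) := by
          have hpos : 0 < q / (q - 1) := by positivity
          rw [ha, ← Real.rpow_mul (hb j), ← Real.rpow_add' (hb j) (by linarith)]
          congr 1; field_simp; ring
        rw [e]
        exact mul_le_mul_of_nonneg_right (Real.rpow_le_rpow (hb j) hij (by positivity))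
          (Real.rpow_nonneg (hb j) _)
      · rw [Real.zero_rpow (by positivity)]
        exact mul_nonneg (Real.rpow_nonneg (hb i) _) (Real.rpow_nonneg (hb j) _)
    refine (Real.rpow_le_rpow (Finset.sum_nonneg fun j _ =>
      Real.rpow_nonneg (by split_ifs; exacts [ha0 j, le_rfl]) _) h2 (by positivity)).trans_eq ?_
    rw [Real.mul_rpow (Real.rpow_nonneg (hb i) _) hT0, ← Real.rpow_mul (hb i)]
    congr 1
    · rw [mul_one_div_cancel (by positivity), Real.rpow_one]
    · congr 1; field_simp
  set F : Fin m → Fin m → ℝ := fun i j => a i * (g i j * if b j ≤ b i then a j else 0) with hF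
  have half : ∑ i, ∑ j, F i j ≤ K * T ^ (2 - 1 / q) := by
    calc ∑ i, ∑ j, F i j ≤ ∑ i, a i * (K * (b i * T ^ (1 - 1 / q))) := by
          refine Finset.sum_le_sum fun i _ => ?_
          rw [hF, ← Finset.mul_sum]
          exact mul_le_mul_of_nonneg_left (inner i) (ha0 i)
      _ = ∑ i, b i ^ (2 * q) * (K * T ^ (1 - 1 / q)) := by
          refine Finset.sum_congr rfl fun i _ => ?_
          have : b i ^ (2 * q) = a i * b i := by
            have h := Real.rpow_add' (hb i) (y := 2 * q - 1) (z := 1) (by linarith)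
            rw [Real.rpow_one, sub_add_cancel] at h
            exact h
          rw [this]; ring
      _ = K * T ^ (2 - 1 / q) := by
          have h1 : 1 / q < 1 := by rw [div_lt_one hq0]; exact hq
          have h := Real.rpow_add' hT0 (y := 1) (z := 1 - 1 / q) (by linarith)
          rw [← Finset.sum_mul, show (2 : ℝ) - 1 / q = 1 + (1 - 1 / q) by ring, h, Real.rpow_one]
          ring
  calc ∑ i, ∑ j, g i j * a i * a j ≤ ∑ i, ∑ j, (F i j + F j i) := by
        refine Finset.sum_le_sum fun i _ => Finset.sum_le_sum fun j _ => ?_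
        have hp : 0 ≤ g i j * a i * a j := mul_nonneg (mul_nonneg (hg i j) (ha0 i)) (ha0 j)
        have e1 : b j ≤ b i → F i j = g i j * a i * a j := fun h => by
          simp only [hF, if_pos h]; ring
        have e2 : b i ≤ b j → F j i = g i j * a i * a j := fun h => by
          simp only [hF, if_pos h, hs j i]; ring
        have n : ∀ i j, 0 ≤ F i j := fun i j => mul_nonneg (ha0 i) (mul_nonneg (hg i j)
          (by split_ifs; exacts [ha0 j, le_rfl]))
        rcases le_total (b j) (b i) with h | h
        · rw [e1 h]; linarith [n j i]
        · rw [e2 h]; linarith [n i j]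
    _ = 2 * ∑ i, ∑ j, F i j := by
        simp only [Finset.sum_add_distrib]
        rw [Finset.sum_comm (f := fun i j => F j i)]; ring
    _ ≤ 2 * K * T ^ (2 - 1 / q) := by linarith

theorem norm_mulVec_sq_le {m n : ℕ} (A : Matrix (Fin m) (Fin n) ℂ) (x : Fin n → ℂ) (i : Fin m) :
    ‖A.mulVec x i‖ ^ 2 ≤ lpnorm 2 (row A i) ^ 2 * lpnorm 2 x ^ 2 := by
  rw [lpnorm_two_sq, lpnorm_two_sq]
  have h : ‖A.mulVec x i‖ ≤ ∑ k, ‖row A i k‖ * ‖x k‖ := by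
    simp only [Matrix.mulVec, dotProduct]
    refine (norm_sum_le _ _).trans_eq (Finset.sum_congr rfl fun k _ => ?_)
    simp [row]
  exact (pow_le_pow_left₀ (norm_nonneg _) h 2).trans (Finset.sum_mul_sq_le_sq_mul_sq _ _ _)

theorem lpnorm_mulVec_le_opNorm_two {m n : ℕ} (A : Matrix (Fin m) (Fin n) ℂ) (x : Fin n → ℂ) :
    lpnorm 2 (A.mulVec x) ≤ opNorm 2 2 A * lpnorm 2 x := by
  rcases eq_or_ne x 0 with rfl | hx
  · simp [lpnorm]
  have bdd : BddAbove (Set.range fun x : {x : Fin n → ℂ // x ≠ 0} =>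
      lpnorm 2 (A.mulVec x.1) / lpnorm 2 x.1) := by
    refine ⟨√(∑ i, lpnorm 2 (row A i) ^ 2), ?_⟩
    rintro _ ⟨⟨y, hy⟩, rfl⟩
    have hy' := lpnorm_pos two_pos hy
    change lpnorm 2 (A.mulVec y) / lpnorm 2 y ≤ _
    rw [div_le_iff₀ hy', ← sq_le_sq₀ (lpnorm_nonneg _ _) (mul_nonneg (Real.sqrt_nonneg _) hy'.le)]
    rw [mul_pow, Real.sq_sqrt (Finset.sum_nonneg fun _ _ => sq_nonneg _), lpnorm_two_sq,
      Finset.sum_mul]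
    exact Finset.sum_le_sum fun i _ => norm_mulVec_sq_le A y i
  exact (div_le_iff₀ (lpnorm_pos two_pos hx)).mp (le_ciSup bdd ⟨x, hx⟩)

theorem mulVec_row {m n : ℕ} (A : Matrix (Fin m) (Fin n) ℂ) (i j : Fin m) :
    A.mulVec (row A j) i = ∑ k, A i k * star (A j k) := rfl

theorem norm_mulVec_row_comm {m n : ℕ} (A : Matrix (Fin m) (Fin n) ℂ) (i j : Fin m) :
    ‖A.mulVec (row A j) i‖ = ‖A.mulVec (row A i) j‖ := by
  rw [← norm_star (A.mulVec (row A i) j), mulVec_row, mulVec_row, star_sum]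
  simp [mul_comm]

theorem mulVec_row_self {m n : ℕ} (A : Matrix (Fin m) (Fin n) ℂ) (i : Fin m) :
    ‖A.mulVec (row A i) i‖ = lpnorm 2 (row A i) ^ 2 := by
  have : A.mulVec (row A i) i = ((∑ k, ‖row A i k‖ ^ 2 : ℝ) : ℂ) := by
    rw [mulVec_row, Complex.ofReal_sum]
    refine Finset.sum_congr rfl fun k _ => ?_
    simp [row, Complex.mul_conj']
  rw [this, lpnorm_two_sq, Complex.norm_real, Real.norm_of_nonneg]
  exact Finset.sum_nonneg fun _ _ => sq_nonneg _

theorem norm_sq_combination_le {m n : ℕ} (A : Matrix (Fin m) (Fin n) ℂ) (c : Fin m → ℂ) :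
    ∑ k, ‖∑ i, c i * A i k‖ ^ 2 ≤
      ∑ i, ∑ j, ‖A.mulVec (row A i) j‖ * ‖c i‖ * ‖c j‖ := by
  have h : ((∑ k, ‖∑ i, c i * A i k‖ ^ 2 : ℝ) : ℂ) =
      ∑ i, ∑ j, A.mulVec (row A i) j * c j * star (c i) := by
    rw [Complex.ofReal_sum]
    simp only [Complex.ofReal_pow, ← Complex.mul_conj', map_sum, mulVec_row, Finset.sum_mul,
      Finset.mul_sum]
    rw [Finset.sum_comm]
    refine Finset.sum_congr rfl fun i _ => ?_
    rw [Finset.sum_comm]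
    refine Finset.sum_congr rfl fun j _ => Finset.sum_congr rfl fun k _ => ?_
    simp only [map_mul, Complex.star_def]; ring
  have h0 : 0 ≤ ∑ k, ‖∑ i, c i * A i k‖ ^ 2 := Finset.sum_nonneg fun _ _ => sq_nonneg _
  rw [← Real.norm_of_nonneg h0, ← Complex.norm_real, h]
  refine (norm_sum_le _ _).trans (Finset.sum_le_sum fun i _ => (norm_sum_le _ _).trans_eq ?_)
  simp [mul_right_comm]

theorem sum_norm_mulVec_rpow_le {m n : ℕ} {q K : ℝ} (hq : 1 < q)
    (A : Matrix (Fin m) (Fin n) ℂ) (hK : ∀ i, lpnorm q (A.mulVec (row A i)) ≤ K)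
    (hK0 : 0 ≤ K) (x : Fin n → ℂ) :
    ∑ i, ‖A.mulVec x i‖ ^ (2 * q) ≤ (2 * K * lpnorm 2 x ^ 2) ^ q := by
  set y := A.mulVec x with hy
  set T := ∑ i, ‖y i‖ ^ (2 * q) with hT
  have hT0 : 0 ≤ T := Finset.sum_nonneg fun i _ => Real.rpow_nonneg (norm_nonneg _) _
  set c : Fin m → ℂ := fun i => star (y i) * ((‖y i‖ ^ (2 * q - 2) : ℝ) : ℂ) with hc
  have hcn : ∀ i, ‖c i‖ = ‖y i‖ ^ (2 * q - 1) := fun i => by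
    have h := Real.rpow_add' (norm_nonneg (y i)) (y := 1) (z := 2 * q - 2) (by linarith)
    rw [Real.rpow_one] at h
    rw [hc, norm_mul, norm_star, Complex.norm_real,
      Real.norm_of_nonneg (Real.rpow_nonneg (norm_nonneg _) _), ← h]
    congr 1; ring
  have hTc : (T : ℂ) = ∑ k, (∑ i, c i * A i k) * x k := by
    calc (T : ℂ) = ∑ i, c i * y i := by
          rw [hT, Complex.ofReal_sum]
          refine Finset.sum_congr rfl fun i _ => ?_
          have h := Real.rpow_add' (norm_nonneg (y i)) (y := 2) (z := 2 * q - 2) (by linarith)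
          rw [add_sub_cancel, Real.rpow_two] at h
          rw [h, hc, Complex.ofReal_mul, Complex.ofReal_pow, ← Complex.mul_conj',
            Complex.star_def]
          ring
      _ = _ := by
          simp only [hy, Matrix.mulVec, dotProduct, Finset.mul_sum, Finset.sum_mul]
          rw [Finset.sum_comm]
          simp only [mul_assoc]
  have h1 : T ^ 2 ≤ (∑ k, ‖∑ i, c i * A i k‖ ^ 2) * lpnorm 2 x ^ 2 := by
    have : T ≤ ∑ k, ‖∑ i, c i * A i k‖ * ‖x k‖ := by
      rw [← Real.norm_of_nonneg hT0, ← Complex.norm_real, hTc]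
      exact (norm_sum_le _ _).trans_eq (by simp only [norm_mul])
    rw [lpnorm_two_sq]
    exact (pow_le_pow_left₀ hT0 this 2).trans (Finset.sum_mul_sq_le_sq_mul_sq _ _ _)
  have h2 := symm_form_le hq (g := fun i j => ‖A.mulVec (row A i) j‖) (K := K)
    (fun _ _ => norm_nonneg _) (fun i j => norm_mulVec_row_comm A j i) hK
    (b := fun i => ‖y i‖) (fun _ => norm_nonneg _)
  have h3 := norm_sq_combination_le A c
  simp only [hcn] at h3
  have h4 : T ^ 2 ≤ 2 * K * T ^ (2 - 1 / q) * lpnorm 2 x ^ 2 :=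
    h1.trans (mul_le_mul_of_nonneg_right (h3.trans h2) (sq_nonneg _))
  have hX : 0 ≤ 2 * K * lpnorm 2 x ^ 2 := by positivity
  rcases hT0.eq_or_lt with h0 | hTpos
  · rw [← h0]; exact Real.rpow_nonneg hX _
  have hq0 : 0 < q := by linarith
  rw [← Real.rpow_inv_le_iff_of_pos hT0 hX hq0, ← one_div]
  have hpos := Real.rpow_pos_of_pos hTpos (2 - 1 / q)
  refine le_of_mul_le_mul_left ?_ hpos
  rw [← Real.rpow_add hTpos, sub_add_cancel, Real.rpow_two]
  linarith

theorem lpnorm_mulVec_sq_le {m n : ℕ} {q M : ℝ} (hq : 2 ≤ q)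
    (A : Matrix (Fin m) (Fin n) ℂ) (hrow : ∀ i, lpnorm q (A.mulVec (row A i)) ≤ M ^ 2)
    (htwo : opNorm 2 2 A ^ 2 ≤ (m : ℝ) ^ ((q - 2) / q) * M ^ 2) (x : Fin n → ℂ) :
    lpnorm q (A.mulVec x) ^ 2 ≤
      (2 * (m : ℝ) ^ (1 / q)) ^ ((q - 2) / (q - 1)) * (M ^ 2 * lpnorm 2 x ^ 2) := by
  have hq0 : 0 < q := by linarith
  have hq1 : 0 < q - 1 := by linarith
  have hq2 : 0 ≤ q - 2 := by linarith
  have hm : (0 : ℝ) ≤ m := Nat.cast_nonneg m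
  set Z := M ^ 2 * lpnorm 2 x ^ 2 with hZ
  have hZ0 : 0 ≤ Z := by positivity
  have h1 := sum_norm_mulVec_rpow_le (by linarith) A hrow (sq_nonneg M) x
  rw [show 2 * M ^ 2 * lpnorm 2 x ^ 2 = 2 * Z by rw [hZ]; ring] at h1
  have h2 : ∑ i, ‖A.mulVec x i‖ ^ 2 ≤ (m : ℝ) ^ ((q - 2) / q) * Z := by
    rw [← lpnorm_two_sq]
    calc lpnorm 2 (A.mulVec x) ^ 2 ≤ (opNorm 2 2 A * lpnorm 2 x) ^ 2 :=
          pow_le_pow_left₀ (lpnorm_nonneg _ _) (lpnorm_mulVec_le_opNorm_two A x) 2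
      _ = opNorm 2 2 A ^ 2 * lpnorm 2 x ^ 2 := mul_pow _ _ _
      _ ≤ (m : ℝ) ^ ((q - 2) / q) * M ^ 2 * lpnorm 2 x ^ 2 :=
          mul_le_mul_of_nonneg_right htwo (sq_nonneg _)
      _ = _ := by rw [hZ]; ring
  have h3 := sum_rpow_le_interp hq (b := fun i => ‖A.mulVec x i‖) fun _ => norm_nonneg _
  rw [← lpnorm_rpow hq0.ne'] at h3
  have h4 : lpnorm q (A.mulVec x) ^ q ≤ ((2 * Z) ^ q) ^ ((q - 2) / (2 * (q - 1))) *
      ((m : ℝ) ^ ((q - 2) / q) * Z) ^ (q / (2 * (q - 1))) :=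
    h3.trans (mul_le_mul
      (Real.rpow_le_rpow (Finset.sum_nonneg fun _ _ => Real.rpow_nonneg (norm_nonneg _) _) h1
        (by positivity))
      (Real.rpow_le_rpow (Finset.sum_nonneg fun _ _ => sq_nonneg _) h2 (by positivity))
      (Real.rpow_nonneg (Finset.sum_nonneg fun _ _ => sq_nonneg _) _) (by positivity))
  have hL := lpnorm_nonneg q (A.mulVec x)
  rw [← Real.rpow_le_rpow_iff (sq_nonneg _) (by positivity) (half_pos hq0)]
  have e : (lpnorm q (A.mulVec x) ^ 2) ^ (q / 2) = lpnorm q (A.mulVec x) ^ q := by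
    rw [← Real.rpow_natCast, ← Real.rpow_mul hL]; congr 1; push_cast; ring
  rw [e]
  refine h4.trans_eq ?_
  have hmr : ∀ s : ℝ, (0 : ℝ) ≤ (m : ℝ) ^ s := fun s => Real.rpow_nonneg hm s
  have hZr : ∀ s : ℝ, (0 : ℝ) ≤ Z ^ s := fun s => Real.rpow_nonneg hZ0 s
  have h2r : ∀ s : ℝ, (0 : ℝ) ≤ (2 : ℝ) ^ s := fun s => by positivity
  rw [Real.mul_rpow two_pos.le hZ0, Real.mul_rpow (h2r _) (hZr _), Real.mul_rpow (hmr _) hZ0,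
    Real.mul_rpow two_pos.le (hmr (1 / q)),
    Real.mul_rpow (mul_nonneg (h2r _) (Real.rpow_nonneg (hmr _) _)) hZ0,
    Real.mul_rpow (h2r _) (Real.rpow_nonneg (hmr _) _)]
  simp only [← Real.rpow_mul hm, ← Real.rpow_mul hZ0, ← Real.rpow_mul two_pos.le]
  have eZ : Z ^ (q / 2) = Z ^ (q * ((q - 2) / (2 * (q - 1)))) * Z ^ (q / (2 * (q - 1))) := by
    rw [← Real.rpow_add_of_nonneg hZ0 (by positivity) (by positivity)]
    congr 1; field_simp; ring
  rw [eZ, show q * ((q - 2) / (2 * (q - 1))) = (q - 2) / (q - 1) * (q / 2) by field_simp,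
    show (q - 2) / q * (q / (2 * (q - 1))) = 1 / q * ((q - 2) / (q - 1)) * (q / 2) by field_simp]
  ring

theorem stmt3 {m n : ℕ} (p q : ℝ) (hp : 2 ≤ p) (hq : 2 ≤ q)
    (A : Matrix (Fin m) (Fin n) ℂ) (hA : A ≠ 0)
    (v : Fin n → ℂ) (hv : v ≠ 0)
    (hsv : lpnorm 2 (A.mulVec v) = opNorm 2 2 A * lpnorm 2 v)
    (M : ℝ)
    (hM : M = sSup {t : ℝ | ∃ x ∈ insert v (Set.range (row A)), x ≠ 0 ∧
      t = lpnorm q (A.mulVec x) / lpnorm p x}) :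
    M ≥ ((2 * (m : ℝ) ^ (1 / q)) ^ ((q - 2) / (q - 1)) * (n : ℝ) ^ ((p - 2) / p)) ^
        (-(1 / 2 : ℝ)) * opNorm p q A := by
  have hp0 : 0 < p := by linarith
  have hq0 : 0 < q := by linarith
  have hfin : {t : ℝ | ∃ x ∈ insert v (Set.range (row A)), x ≠ 0 ∧
      t = lpnorm q (A.mulVec x) / lpnorm p x}.Finite :=
    (((Set.finite_range (row A)).insert v).image
      fun x => lpnorm q (A.mulVec x) / lpnorm p x).subset
      fun _ ⟨x, hx, _, ht⟩ => ⟨x, hx, ht.symm⟩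
  have hle : ∀ x ∈ insert v (Set.range (row A)), x ≠ 0 →
      lpnorm q (A.mulVec x) ≤ M * lpnorm p x := fun x hx hx0 => by
    rw [← div_le_iff₀ (lpnorm_pos hp0 hx0), hM]
    exact le_csSup hfin.bddAbove ⟨x, hx, hx0, rfl⟩
  have hM0 : 0 ≤ M := nonneg_of_mul_nonneg_left
    ((lpnorm_nonneg _ _).trans (hle v (Set.mem_insert _ _) hv)) (lpnorm_pos hp0 hv)
  have hrow : ∀ i, lpnorm q (A.mulVec (row A i)) ≤ M ^ 2 := fun i => by
    rcases eq_or_ne (row A i) 0 with h | h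
    · rw [h, Matrix.mulVec_zero]
      simpa [lpnorm, hq0.ne'] using sq_nonneg M
    have h1 := (hle _ (Set.mem_insert_of_mem _ ⟨i, rfl⟩) h).trans
      (mul_le_mul_of_nonneg_left (lpnorm_anti two_pos hp (row A i)) hM0)
    have h2 := (norm_le_lpnorm hq0 (A.mulVec (row A i)) i).trans h1
    rw [mulVec_row_self, sq] at h2
    have h3 := le_of_mul_le_mul_right h2 (lpnorm_pos two_pos h)
    rw [sq]
    exact h1.trans (mul_le_mul_of_nonneg_left h3 hM0)
  have htwo : opNorm 2 2 A ^ 2 ≤ (m : ℝ) ^ ((q - 2) / q) * M ^ 2 := by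
    have hv2 := pow_pos (lpnorm_pos two_pos hv) 2
    refine le_of_mul_le_mul_right ?_ hv2
    rw [← mul_pow, ← hsv]
    have h1 := (hle v (Set.mem_insert _ _) hv).trans
      (mul_le_mul_of_nonneg_left (lpnorm_anti two_pos hp v) hM0)
    have h2 := pow_le_pow_left₀ (lpnorm_nonneg _ _) h1 2
    rw [mul_pow] at h2
    rw [mul_assoc]
    exact (lpnorm_two_sq_le hq _).trans (mul_le_mul_of_nonneg_left h2 (by positivity))
  obtain ⟨i, j, -⟩ : ∃ i j, A i j ≠ 0 := by
    by_contra! h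
    exact hA (Matrix.ext h)
  have hm : (0 : ℝ) < m := Nat.cast_pos.mpr i.pos
  have hn : (0 : ℝ) < n := Nat.cast_pos.mpr j.pos
  set C := (2 * (m : ℝ) ^ (1 / q)) ^ ((q - 2) / (q - 1)) * (n : ℝ) ^ ((p - 2) / p) with hC
  have hC0 : 0 < C := by positivity
  have hop : opNorm p q A ≤ √C * M := by
    have : Nonempty {x : Fin n → ℂ // x ≠ 0} := ⟨⟨v, hv⟩⟩
    refine ciSup_le fun ⟨x, hx⟩ => ?_
    rw [div_le_iff₀ (lpnorm_pos hp0 hx)]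
    have hx0 := lpnorm_nonneg p x
    refine (sq_le_sq₀ (lpnorm_nonneg _ _) (by positivity)).mp ?_
    rw [mul_pow, mul_pow, Real.sq_sqrt hC0.le]
    refine (lpnorm_mulVec_sq_le hq A hrow htwo x).trans ?_
    calc _ ≤ (2 * (m : ℝ) ^ (1 / q)) ^ ((q - 2) / (q - 1)) *
          (M ^ 2 * ((n : ℝ) ^ ((p - 2) / p) * lpnorm p x ^ 2)) := by
          gcongr
          exact lpnorm_two_sq_le hp x
      _ = C * M ^ 2 * lpnorm p x ^ 2 := by rw [hC]; ring
  rw [Real.rpow_neg hC0.le, ← Real.sqrt_eq_rpow, ge_iff_le,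
    inv_mul_le_iff₀ (Real.sqrt_pos.mpr hC0)]
  exact hop
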